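/- arXiv:2008.09924 — 4 statements merged into one kernel-verified Lean document; each statement's English description precedes it below -/
import Mathlib

section
/- Every support datum σ on a monoidal triangulated category K is a weak support datum: if σ satisfies conditions (i)-(v) of a support datum, then Φ_σ(I ⊗ J) = Φ_σ(I) ∩ Φ_σ(J) for all thick two-sided ideals I and J of K. -/
open CategoryTheory CategoryTheory.Limits CategoryTheory.Pretriangulated
open CategoryTheory.MonoidalCategory

universe w v u

variable (C : Type u) [Category.{v} C] [MonoidalCategory C] [Preadditive C]
  [HasZeroObject C] [HasBinaryBiproducts C] [HasShift C ℤ]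
  [∀ n : ℤ, (shiftFunctor C n).Additive] [Pretriangulated C]

structure ThickSubcat where
  carrier : Set C
  zero_mem : ∀ A : C, IsZero A → A ∈ carrier
  iso_closed : ∀ {A B : C}, (A ≅ B) → A ∈ carrier → B ∈ carrier
  shift_closed : ∀ (A : C) (n : ℤ), A ∈ carrier → A⟦n⟧ ∈ carrier
  triangle_closed : ∀ T ∈ distTriang C,
    Triangle.obj₁ T ∈ carrier → Triangle.obj₂ T ∈ carrier → Triangle.obj₃ T ∈ carrier
  summand_closed : ∀ A B : C, (A ⊞ B) ∈ carrier → A ∈ carrier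

structure ThickRightIdeal extends ThickSubcat C where
  tensor_right : ∀ A ∈ carrier, ∀ B : C, A ⊗ B ∈ carrier

structure ThickIdeal extends ThickRightIdeal C where
  tensor_left : ∀ A ∈ carrier, ∀ B : C, B ⊗ A ∈ carrier

variable {C}

def ThickIdeal.IsProper (P : ThickIdeal C) : Prop := P.carrier ≠ Set.univ

def ThickIdeal.IsPrime (P : ThickIdeal C) : Prop :=
  P.IsProper ∧ ∀ I J : ThickIdeal C,
    (∀ A ∈ I.carrier, ∀ B ∈ J.carrier, A ⊗ B ∈ P.carrier) →
    I.carrier ⊆ P.carrier ∨ J.carrier ⊆ P.carrier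

def ThickIdeal.IsCompletelyPrime (P : ThickIdeal C) : Prop :=
  P.IsProper ∧ ∀ A B : C, A ⊗ B ∈ P.carrier → A ∈ P.carrier ∨ B ∈ P.carrier

def ThickIdeal.IsSemiprime (Q : ThickIdeal C) : Prop :=
  ∃ S : Set (ThickIdeal C), (∀ P ∈ S, P.IsPrime) ∧ Q.carrier = ⋂ P ∈ S, P.carrier

variable (C)

/-- The thick two-sided ideal generated by a set of objects. -/
def genIdeal (S : Set C) : ThickIdeal C where
  carrier := {A : C | ∀ I : ThickIdeal C, S ⊆ I.carrier → A ∈ I.carrier}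
  zero_mem := fun A hA I _ => I.zero_mem A hA
  iso_closed := fun {A B} e hA I hI => I.iso_closed e (hA I hI)
  shift_closed := fun A n hA I hI => I.shift_closed A n (hA I hI)
  triangle_closed := fun T hT h1 h2 I hI =>
    I.triangle_closed T hT (h1 I hI) (h2 I hI)
  summand_closed := fun A B hAB I hI => I.summand_closed A B (hAB I hI)
  tensor_right := fun A hA B I hI => I.tensor_right A (hA I hI) B
  tensor_left := fun A hA B I hI => I.tensor_left A (hA I hI) B

/-- The thick right ideal generated by a set of objects. -/
def genRightIdeal (S : Set C) : ThickRightIdeal C where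
  carrier := {A : C | ∀ I : ThickRightIdeal C, S ⊆ I.carrier → A ∈ I.carrier}
  zero_mem := fun A hA I _ => I.zero_mem A hA
  iso_closed := fun {A B} e hA I hI => I.iso_closed e (hA I hI)
  shift_closed := fun A n hA I hI => I.shift_closed A n (hA I hI)
  triangle_closed := fun T hT h1 h2 I hI =>
    I.triangle_closed T hT (h1 I hI) (h2 I hI)
  summand_closed := fun A B hAB I hI => I.summand_closed A B (hAB I hI)
  tensor_right := fun A hA B I hI => I.tensor_right A (hA I hI) B

/-- The set of tensor products of objects from `I` and from `J`. -/
def tensorSet (I J : ThickIdeal C) : Set C :=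
  {X : C | ∃ A ∈ I.carrier, ∃ B ∈ J.carrier, X = A ⊗ B}

/-- `Φ_σ(S) = ⋃_{A ∈ S} σ(A)`. -/
def Phi {Y : Type w} (s : C → Set Y) (S : Set C) : Set Y := ⋃ A ∈ S, s A

/-- A support datum with values in subsets of a space `Y`. -/
structure SupportDatum (Y : Type w) where
  s : C → Set Y
  zero : ∀ A : C, IsZero A → s A = ∅
  unit : s (𝟙_ C) = Set.univ
  sum : ∀ A B : C, s (A ⊞ B) = s A ∪ s B
  shift : ∀ A : C, s (A⟦(1 : ℤ)⟧) = s A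
  triangle : ∀ T ∈ distTriang C,
    s (Triangle.obj₁ T) ⊆ s (Triangle.obj₂ T) ∪ s (Triangle.obj₃ T)
  tensor : ∀ A B : C, (⋃ X : C, s (A ⊗ X ⊗ B)) = s A ∩ s B

/-- A weak support datum with values in subsets of a space `Y`. -/
structure WeakSupportDatum (Y : Type w) where
  s : C → Set Y
  zero : ∀ A : C, IsZero A → s A = ∅
  unit : s (𝟙_ C) = Set.univ
  sum : ∀ A B : C, s (A ⊞ B) = s A ∪ s B
  shift : ∀ A : C, s (A⟦(1 : ℤ)⟧) = s A
  triangle : ∀ T ∈ distTriang C,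
    s (Triangle.obj₁ T) ⊆ s (Triangle.obj₂ T) ∪ s (Triangle.obj₃ T)
  tensorIdeal : ∀ I J : ThickIdeal C,
    Phi C s (genIdeal C (tensorSet C I J)).carrier =
      Phi C s I.carrier ∩ Phi C s J.carrier

/-- `n`-th tensor power of an object. -/
def tpow (M : C) : ℕ → C
  | 0 => 𝟙_ C
  | n + 1 => tpow M n ⊗ M

def Spc := {P : ThickIdeal C // P.IsPrime}

def suppV (M : C) : Set (Spc C) := {P : Spc C | M ∉ P.1.carrier}

instance : TopologicalSpace (Spc C) :=
  TopologicalSpace.generateFrom {U : Set (Spc C) | ∃ M : C, U = (suppV C M)ᶜ}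

def CPSpc := {P : ThickIdeal C // P.IsCompletelyPrime}

def suppVCP (M : C) : Set (CPSpc C) := {P : CPSpc C | M ∉ P.1.carrier}

/-- Every support datum is a weak support datum: for all thick
two-sided ideals `I`, `J`, `Φ_σ(I ⊗ J) = Φ_σ(I) ∩ Φ_σ(J)`, where `I ⊗ J` is the
thick two-sided ideal generated by the products `A ⊗ B`, `A ∈ I`, `B ∈ J`. -/
theorem supportDatum_is_weakSupportDatum {Y : Type w} (σ : SupportDatum C Y)
    (I J : ThickIdeal C) :
    Phi C σ.s (genIdeal C (tensorSet C I J)).carrier =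
      Phi C σ.s I.carrier ∩ Phi C σ.s J.carrier := by
  apply Set.Subset.antisymm
  · intro y hy
    simp only [Phi, Set.mem_inter_iff, Set.mem_iUnion, exists_prop] at hy ⊢
    obtain ⟨A, hA, hy⟩ := hy
    refine ⟨⟨A, hA I ?_, hy⟩, ⟨A, hA J ?_, hy⟩⟩
    · rintro _ ⟨A, hA, B, -, rfl⟩
      exact I.tensor_right A hA B
    · rintro _ ⟨A, -, B, hB, rfl⟩
      exact J.tensor_left B hB A
  · intro y hy
    simp only [Phi, Set.mem_inter_iff, Set.mem_iUnion, exists_prop] at hy ⊢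
    obtain ⟨⟨A, hA, hyA⟩, ⟨B, hB, hyB⟩⟩ := hy
    have hy : y ∈ ⋃ X : C, σ.s (A ⊗ X ⊗ B) := by
      rw [σ.tensor]
      exact ⟨hyA, hyB⟩
    obtain ⟨X, hX⟩ := Set.mem_iUnion.mp hy
    exact ⟨A ⊗ X ⊗ B, fun _ hK => hK ⟨A, hA, X ⊗ B, J.tensor_left B hB X, rfl⟩, hX⟩
end

section
/- Let K be a monoidal triangulated category. For every support datum σ : K → X(Y) such that σ(A) is a closed subset of Y for each object A of K, there is a unique continuous map f_σ : Y → Spc K satisfying σ(A) = f_σ⁻¹(V(A)) for all objects A of K. -/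
open CategoryTheory CategoryTheory.Limits CategoryTheory.Pretriangulated
open CategoryTheory.MonoidalCategory

universe w v u

variable (C : Type u) [Category.{v} C] [MonoidalCategory C] [Preadditive C]
  [HasZeroObject C] [HasBinaryBiproducts C] [HasShift C ℤ]
  [∀ n : ℤ, (shiftFunctor C n).Additive] [Pretriangulated C]

variable {C}

variable (C)

variable {C}

theorem ThickIdeal.ext_carrier {P Q : ThickIdeal C} (h : P.carrier = Q.carrier) : P = Q := by
  obtain ⟨⟨⟨p, _, _, _, _, _⟩, _⟩, _⟩ := P
  obtain ⟨⟨⟨q, _, _, _, _, _⟩, _⟩, _⟩ := Q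
  obtain rfl : p = q := h
  rfl

namespace SupportDatum

variable {Y : Type w} (σ : SupportDatum C Y)

open scoped ZeroObject in
theorem subset_of_iso {A B : C} (e : A ≅ B) : σ.s A ⊆ σ.s B := by
  have hT : Triangle.mk e.hom (0 : B ⟶ (0 : C)) 0 ∈ distTriang C :=
    isomorphic_distinguished _ (contractible_distinguished B) _
      (Triangle.isoMk _ _ e (Iso.refl B) (Iso.refl (0 : C)) rfl
        (zero_comp.trans comp_zero.symm) (zero_comp.trans comp_zero.symm))
  have h : σ.s A ⊆ σ.s B ∪ σ.s (0 : C) := σ.triangle _ hT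
  rwa [σ.zero 0 (isZero_zero C), Set.union_empty] at h

theorem eq_of_iso {A B : C} (e : A ≅ B) : σ.s A = σ.s B :=
  (σ.subset_of_iso e).antisymm (σ.subset_of_iso e.symm)

theorem s_shift_int (A : C) (n : ℤ) : σ.s (A⟦n⟧) = σ.s A := by
  have step (n : ℤ) : σ.s (A⟦n + 1⟧) = σ.s (A⟦n⟧) :=
    (σ.eq_of_iso ((shiftFunctorAdd C n 1).app A)).trans (σ.shift _)
  induction n using Int.induction_on with
  | zero => exact σ.eq_of_iso ((shiftFunctorZero C ℤ).app A)
  | succ n ih => rw [step, ih]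
  | pred n ih => rw [← step, sub_add_cancel, ih]

theorem s_tensor_subset (A B : C) : σ.s (A ⊗ B) ⊆ σ.s A ∩ σ.s B := by
  rw [← σ.tensor A B, σ.eq_of_iso (whiskerLeftIso A (λ_ B).symm)]
  exact Set.subset_iUnion (fun X : C => σ.s (A ⊗ X ⊗ B)) (𝟙_ C)

theorem s_obj₃_subset (T : Triangle C) (hT : T ∈ distTriang C) :
    σ.s T.obj₃ ⊆ σ.s T.obj₁ ∪ σ.s T.obj₂ := by
  have h : σ.s T.obj₃ ⊆ σ.s (T.obj₁⟦(1 : ℤ)⟧) ∪ σ.s (T.obj₂⟦(1 : ℤ)⟧) :=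
    σ.triangle _ (rot_of_distTriang _ (rot_of_distTriang _ hT))
  rwa [σ.shift, σ.shift] at h

/-- The thick ideal of objects whose support misses the point `y`. -/
def idealAt (y : Y) : ThickIdeal C where
  carrier := {A | y ∉ σ.s A}
  zero_mem A hA := by simp [σ.zero A hA]
  iso_closed e hA hB := hA (σ.subset_of_iso e.symm hB)
  shift_closed A n hA := by simpa [σ.s_shift_int] using hA
  triangle_closed T hT h₁ h₂ h₃ := (σ.s_obj₃_subset T hT h₃).elim h₁ h₂
  summand_closed A B hAB hA := hAB (σ.sum A B ▸ Or.inl hA)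
  tensor_right A hA B hAB := hA (σ.s_tensor_subset A B hAB).1
  tensor_left A hA B hBA := hA (σ.s_tensor_subset B A hBA).2

theorem mem_idealAt {y : Y} {A : C} : A ∈ (σ.idealAt y).carrier ↔ y ∉ σ.s A := Iff.rfl

theorem isPrime_idealAt (y : Y) : (σ.idealAt y).IsPrime := by
  refine ⟨fun h => ?_, fun I J hIJ => ?_⟩
  · have h_unit : 𝟙_ C ∈ (σ.idealAt y).carrier := h ▸ Set.mem_univ _
    exact h_unit (σ.unit ▸ Set.mem_univ y)
  · by_contra! h
    obtain ⟨⟨A, hAI, hA⟩, ⟨B, hBJ, hB⟩⟩ := h.imp Set.not_subset.1 Set.not_subset.1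
    rw [mem_idealAt, not_not] at hA hB
    have hAB : y ∈ ⋃ X : C, σ.s (A ⊗ X ⊗ B) := σ.tensor A B ▸ ⟨hA, hB⟩
    obtain ⟨X, hX⟩ := Set.mem_iUnion.1 hAB
    exact hIJ A hAI _ (J.tensor_left B hBJ X) hX

/-- The map to the noncommutative Balmer spectrum induced by a support datum. -/
def toSpc (y : Y) : Spc C := ⟨σ.idealAt y, σ.isPrime_idealAt y⟩

theorem preimage_toSpc (A : C) : σ.toSpc ⁻¹' suppV C A = σ.s A :=
  Set.ext fun _ => not_not

theorem continuous_toSpc [TopologicalSpace Y] (hcl : ∀ A : C, IsClosed (σ.s A)) :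
    Continuous σ.toSpc := by
  refine continuous_generateFrom_iff.2 ?_
  rintro _ ⟨M, rfl⟩
  rw [Set.preimage_compl, preimage_toSpc]
  exact (hcl M).isOpen_compl

end SupportDatum

variable (C)

/-- For every support datum `σ : K → X(Y)` with closed values,
there is a unique continuous map `f_σ : Y → Spc K` with
`σ(A) = f_σ⁻¹(V(A))` for all objects `A`. -/
theorem universality_of_Spc (Y : Type w) [TopologicalSpace Y]
    (σ : SupportDatum C Y) (hcl : ∀ A : C, IsClosed (σ.s A)) :
    ∃! f : Y → Spc C,
      Continuous f ∧ ∀ A : C, σ.s A = f ⁻¹' suppV C A := by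
  refine ⟨σ.toSpc, ⟨σ.continuous_toSpc hcl, fun A => (σ.preimage_toSpc A).symm⟩, ?_⟩
  rintro g ⟨-, hg⟩
  funext y
  refine Subtype.ext (ThickIdeal.ext_carrier (Set.ext fun A => ?_))
  have h : y ∈ σ.s A ↔ A ∉ (g y).1.carrier := Set.ext_iff.1 (hg A) y
  exact not_not.symm.trans (not_congr h.symm)
end

section
/- If K is a monoidal triangulated category in which every object is either left or right dualizable, then every thick two-sided ideal of K is semiprime (an intersection of prime ideals). -/
open CategoryTheory CategoryTheory.Limits CategoryTheory.Pretriangulated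
open CategoryTheory.MonoidalCategory

universe w v u

variable (C : Type u) [Category.{v} C] [MonoidalCategory C] [Preadditive C]
  [HasZeroObject C] [HasBinaryBiproducts C] [HasShift C ℤ]
  [∀ n : ℤ, (shiftFunctor C n).Additive] [Pretriangulated C]

variable {C}

variable (C)

section

variable {C}

/-- `f` is a weak kernel of `g`, except that `f ≫ g = 0` is not required. -/
def IsWeakKer {X Y Z : C} (f : X ⟶ Y) (g : Y ⟶ Z) : Prop :=
  ∀ ⦃W : C⦄ (h : W ⟶ Y), h ≫ g = 0 → ∃ k : W ⟶ X, k ≫ f = h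

/-- `g` is a weak cokernel of `f`, except that `f ≫ g = 0` is not required. -/
def IsWeakCoker {X Y Z : C} (f : X ⟶ Y) (g : Y ⟶ Z) : Prop :=
  ∀ ⦃W : C⦄ (h : Y ⟶ W), f ≫ h = 0 → ∃ k : Z ⟶ W, g ≫ k = h

theorem isWeakKer_iff_isWeakCoker {X Y Z : C} (f : X ⟶ Y) (g : Y ⟶ Z) :
    IsWeakKer f g ↔ IsWeakCoker f g := by
  constructor
  · intro H W h hh
    obtain ⟨D, c, d, hT⟩ := distinguished_cocone_triangle₁ g
    obtain ⟨k, rfl⟩ := H c (comp_distTriang_mor_zero₁₂ _ hT)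
    obtain ⟨l, hl⟩ := Triangle.yoneda_exact₂ _ hT h
      (show (k ≫ f) ≫ h = 0 by rw [Category.assoc, hh, comp_zero])
    exact ⟨l, hl.symm⟩
  · intro H W h hh
    obtain ⟨D, c, d, hT⟩ := distinguished_cocone_triangle f
    obtain ⟨k, rfl⟩ := H c (comp_distTriang_mor_zero₁₂ _ hT)
    obtain ⟨l, hl⟩ := Triangle.coyoneda_exact₂ _ hT h
      (show h ≫ g ≫ k = 0 by rw [← Category.assoc, hh, zero_comp])
    exact ⟨l, hl.symm⟩

/-- A functor is weakly exact if it preserves weak kernels. -/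
def IsWeaklyExact (F : C ⥤ C) : Prop :=
  ∀ ⦃X Y Z : C⦄ (f : X ⟶ Y) (g : Y ⟶ Z), IsWeakKer f g → IsWeakKer (F.map f) (F.map g)

theorem isWeaklyExact_of_rightAdjoint {L R : C ⥤ C} (adj : L ⊣ R) : IsWeaklyExact R := by
  intro X Y Z f g H W h hh
  have := adj.isLeftAdjoint
  obtain ⟨k, hk⟩ := H ((adj.homEquiv _ _).symm h) (by
    rw [← Adjunction.homEquiv_naturality_right_symm, hh]
    simp [Adjunction.homEquiv_counit])
  refine ⟨adj.homEquiv _ _ k, ?_⟩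
  rw [← Adjunction.homEquiv_naturality_right, hk, Equiv.apply_symm_apply]

theorem isWeaklyExact_of_leftAdjoint {L R : C ⥤ C} (adj : L ⊣ R) : IsWeaklyExact L := by
  intro X Y Z f g H
  rw [isWeakKer_iff_isWeakCoker] at H ⊢
  intro W h hh
  have := adj.isRightAdjoint
  obtain ⟨k, hk⟩ := H (adj.homEquiv _ _ h) (by
    rw [← Adjunction.homEquiv_naturality_left, hh]
    simp [Adjunction.homEquiv_unit])
  refine ⟨(adj.homEquiv _ _).symm k, ?_⟩
  rw [← Adjunction.homEquiv_naturality_left_symm, hk, Equiv.symm_apply_apply]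

theorem isWeaklyExact_shiftFunctor (n : ℤ) : IsWeaklyExact (shiftFunctor C n) :=
  isWeaklyExact_of_leftAdjoint (shiftFunctor C n).asEquivalence.toAdjunction

theorem isWeaklyExact_tensorLeft (A : C)
    (h : (∃ B : C, Nonempty (ExactPairing A B)) ∨ (∃ B : C, Nonempty (ExactPairing B A))) :
    IsWeaklyExact (tensorLeft A) := by
  obtain ⟨B, ⟨_⟩⟩ | ⟨B, ⟨_⟩⟩ := h
  · exact isWeaklyExact_of_rightAdjoint (tensorLeftAdjunction A B)
  · exact isWeaklyExact_of_leftAdjoint (tensorLeftAdjunction B A)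

theorem isWeaklyExact_tensorRight (A : C)
    (h : (∃ B : C, Nonempty (ExactPairing A B)) ∨ (∃ B : C, Nonempty (ExactPairing B A))) :
    IsWeaklyExact (tensorRight A) := by
  obtain ⟨B, ⟨_⟩⟩ | ⟨B, ⟨_⟩⟩ := h
  · exact isWeaklyExact_of_leftAdjoint (tensorRightAdjunction A B)
  · exact isWeaklyExact_of_rightAdjoint (tensorRightAdjunction B A)

theorem isWeakKer_of_distTriang (T : Triangle C) (hT : T ∈ distTriang C) :
    IsWeakKer T.mor₁ T.mor₂ := fun _ h hh =>
  (Triangle.coyoneda_exact₂ T hT h hh).imp fun _ e => e.symm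

namespace ThickSubcat

variable (L : ThickSubcat C)

theorem obj₂_mem (T : Triangle C) (hT : T ∈ distTriang C) (h₁ : T.obj₁ ∈ L.carrier)
    (h₃ : T.obj₃ ∈ L.carrier) : T.obj₂ ∈ L.carrier :=
  L.triangle_closed _ (inv_rot_of_distTriang _ hT) (L.shift_closed _ (-1) h₃) h₁

theorem biprod_mem {A B : C} (hA : A ∈ L.carrier) (hB : B ∈ L.carrier) :
    (A ⊞ B : C) ∈ L.carrier :=
  L.obj₂_mem _ (binaryBiproductTriangle_distinguished A B) hA hB

theorem mem_of_retract {X Y : C} (i : X ⟶ Y) (r : Y ⟶ X) (h : i ≫ r = 𝟙 X)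
    (hY : Y ∈ L.carrier) : X ∈ L.carrier := by
  obtain ⟨Z, g, d, hT⟩ := distinguished_cocone_triangle i
  have : Mono i := mono_of_mono_fac h
  have hd : d = 0 := ((Triangle.mk i g d).mor₃_eq_zero_iff_mono₁ hT).2 this
  obtain ⟨e, -⟩ := exists_iso_binaryBiproduct_of_distTriang _ hT hd
  exact L.summand_closed X Z (L.iso_closed e hY)

/-- The intersection of two thick subcategories. -/
def inter (L M : ThickSubcat C) : ThickSubcat C where
  carrier := L.carrier ∩ M.carrier
  zero_mem A h := ⟨L.zero_mem A h, M.zero_mem A h⟩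
  iso_closed e h := ⟨L.iso_closed e h.1, M.iso_closed e h.2⟩
  shift_closed A n h := ⟨L.shift_closed A n h.1, M.shift_closed A n h.2⟩
  triangle_closed T hT h₁ h₂ :=
    ⟨L.triangle_closed T hT h₁.1 h₂.1, M.triangle_closed T hT h₁.2 h₂.2⟩
  summand_closed A B h := ⟨L.summand_closed A B h.1, M.summand_closed A B h.2⟩

/-- The morphism `f` factors through an object of `L`. -/
def Factors {X Y : C} (f : X ⟶ Y) : Prop :=
  ∃ Z ∈ L.carrier, ∃ (a : X ⟶ Z) (b : Z ⟶ Y), a ≫ b = f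

variable {L}

theorem Factors.precomp {X Y : C} {f : X ⟶ Y} (h : L.Factors f) {W : C} (g : W ⟶ X) :
    L.Factors (g ≫ f) := by
  obtain ⟨Z, hZ, a, b, rfl⟩ := h
  exact ⟨Z, hZ, g ≫ a, b, Category.assoc _ _ _⟩

/-- Every morphism from `X` to an object of `K` factors through an object of `L`. -/
def AllFactor (L K : ThickSubcat C) (X : C) : Prop :=
  ∀ Y ∈ K.carrier, ∀ f : X ⟶ Y, L.Factors f

theorem AllFactor.of_retract {K : ThickSubcat C} {X Y : C} (i : X ⟶ Y) (r : Y ⟶ X)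
    (h : i ≫ r = 𝟙 X) (hY : AllFactor L K Y) : AllFactor L K X := by
  intro W hW f
  simpa [reassoc_of% h] using (hY W hW (r ≫ f)).precomp i

theorem AllFactor.middle_of_distTriang {K : ThickSubcat C} (hLK : L.carrier ⊆ K.carrier)
    (T : Triangle C) (hT : T ∈ distTriang C) (h₃ : AllFactor L K T.obj₃)
    {Y : C} (hY : Y ∈ K.carrier) (f : T.obj₂ ⟶ Y) (h₁ : L.Factors (T.mor₁ ≫ f)) :
    L.Factors f := by
  obtain ⟨l, hl, a, b, hab⟩ := h₁
  obtain ⟨Y', p, d, hT'⟩ := distinguished_cocone_triangle b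
  have hY' : Y' ∈ K.carrier := K.triangle_closed _ hT' (hLK hl) hY
  have hbp : b ≫ p = 0 := comp_distTriang_mor_zero₁₂ _ hT'
  have hpd : p ≫ d = 0 := comp_distTriang_mor_zero₂₃ _ hT'
  obtain ⟨g, hg⟩ := Triangle.yoneda_exact₂ T hT (f ≫ p) (by
    rw [← Category.assoc, ← hab, Category.assoc, hbp, comp_zero])
  obtain ⟨l', hl', a', b', rfl⟩ := h₃ Y' hY' g
  obtain ⟨W, u, v, hW⟩ := distinguished_cocone_triangle₂ (b' ≫ d)
  have hWL : W ∈ L.carrier := L.obj₂_mem _ hW hl hl'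
  obtain ⟨w, -, hw⟩ : ∃ w : W ⟶ Y, u ≫ w = 𝟙 l ≫ b ∧ v ≫ b' = w ≫ p :=
    complete_distinguished_triangle_morphism₂ _ _ hW hT' (𝟙 l) b'
      (show (b' ≫ d) ≫ (𝟙 l)⟦(1 : ℤ)⟧' = b' ≫ d by simp)
  obtain ⟨s, hs⟩ : ∃ s : T.obj₂ ⟶ W, T.mor₂ ≫ a' = s ≫ v :=
    Triangle.coyoneda_exact₃ _ hW (T.mor₂ ≫ a') (show (T.mor₂ ≫ a') ≫ b' ≫ d = 0 by
      rw [Category.assoc, ← Category.assoc a', ← Category.assoc, ← hg, Category.assoc, hpd,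
        comp_zero])
  obtain ⟨t, ht⟩ : ∃ t : T.obj₂ ⟶ l, f - s ≫ w = t ≫ b :=
    Triangle.coyoneda_exact₂ _ hT' (f - s ≫ w) (show (f - s ≫ w) ≫ p = 0 by
      rw [Preadditive.sub_comp, hg, Category.assoc, ← hw, ← Category.assoc s, ← hs,
        Category.assoc, sub_self])
  refine ⟨W ⊞ l, L.biprod_mem hWL hl, biprod.lift s t, biprod.desc w b, ?_⟩
  rw [biprod.lift_desc, ← ht, add_sub_cancel]

theorem AllFactor.middle {K : ThickSubcat C} (hLK : L.carrier ⊆ K.carrier)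
    {X₁ X₂ X₃ : C} (f : X₁ ⟶ X₂) (g : X₂ ⟶ X₃) (hfg : IsWeakKer f g)
    (h₁ : AllFactor L K X₁) (h₃ : AllFactor L K X₃) : AllFactor L K X₂ := by
  intro Y hY h
  obtain ⟨D, c, d, hT⟩ := distinguished_cocone_triangle₁ g
  obtain ⟨k, rfl⟩ := hfg c (comp_distTriang_mor_zero₁₂ _ hT)
  refine AllFactor.middle_of_distTriang hLK _ hT h₃ hY h
    (show L.Factors ((k ≫ f) ≫ h) from ?_)
  rw [Category.assoc]
  exact (h₁ Y hY (f ≫ h)).precomp k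

end ThickSubcat

/-- A morphism out of a dualizable object factors through a tensor product of its source, a dual
and its target. -/
theorem exists_factorization_of_dualizable {A Y : C}
    (hA : (∃ B : C, Nonempty (ExactPairing A B)) ∨ (∃ B : C, Nonempty (ExactPairing B A)))
    (f : A ⟶ Y) :
    ∃ (B Z : C) (a : A ⟶ Z) (b : Z ⟶ Y), a ≫ b = f ∧
      (Z = (Y ⊗ B) ⊗ A ∨ Z = A ⊗ (B ⊗ Y)) := by
  obtain ⟨B, ⟨_⟩⟩ | ⟨B, ⟨_⟩⟩ := hA
  · let adj := tensorRightAdjunction A B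
    have h : (adj.homEquiv (𝟙_ C) Y).symm (adj.homEquiv (𝟙_ C) Y ((λ_ A).hom ≫ f)) =
        (λ_ A).hom ≫ f := Equiv.symm_apply_apply _ _
    rw [Adjunction.homEquiv_counit] at h
    refine ⟨B, (Y ⊗ B) ⊗ A,
      (λ_ A).inv ≫ (tensorRight A).map (adj.homEquiv (𝟙_ C) Y ((λ_ A).hom ≫ f)),
      adj.counit.app Y, ?_, Or.inl rfl⟩
    rw [Category.assoc]
    exact (congrArg ((λ_ A).inv ≫ ·) h).trans (Iso.inv_hom_id_assoc _ _)
  · let adj := tensorLeftAdjunction B A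
    have h : (adj.homEquiv (𝟙_ C) Y).symm (adj.homEquiv (𝟙_ C) Y ((ρ_ A).hom ≫ f)) =
        (ρ_ A).hom ≫ f := Equiv.symm_apply_apply _ _
    rw [Adjunction.homEquiv_counit] at h
    refine ⟨B, A ⊗ (B ⊗ Y),
      (ρ_ A).inv ≫ (tensorLeft A).map (adj.homEquiv (𝟙_ C) Y ((ρ_ A).hom ≫ f)),
      adj.counit.app Y, ?_, Or.inr rfl⟩
    rw [Category.assoc]
    exact (congrArg ((ρ_ A).inv ≫ ·) h).trans (Iso.inv_hom_id_assoc _ _)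

/-- A functor is stabilizing if it is weakly exact and maps every thick ideal into itself. -/
structure IsStabilizing (F : C ⥤ C) : Prop where
  weaklyExact : IsWeaklyExact F
  map_mem : ∀ (I : ThickIdeal C), ∀ A ∈ I.carrier, F.obj A ∈ I.carrier

theorem IsStabilizing.id : IsStabilizing (𝟭 C) :=
  ⟨fun _ _ _ _ _ H => H, fun _ _ h => h⟩

theorem IsStabilizing.comp {F G : C ⥤ C} (hF : IsStabilizing F) (hG : IsStabilizing G) :
    IsStabilizing (F ⋙ G) :=
  ⟨fun _ _ _ f g H => hG.weaklyExact _ _ (hF.weaklyExact f g H),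
    fun I A hA => hG.map_mem I _ (hF.map_mem I A hA)⟩

theorem IsStabilizing.shiftFunctor (n : ℤ) : IsStabilizing (shiftFunctor C n) :=
  ⟨isWeaklyExact_shiftFunctor n, fun I A hA => I.shift_closed A n hA⟩

/-- The objects all of whose images under stabilizing functors have the property that their
morphisms to objects of `K` factor through `L`. -/
def factorIdeal (hdual : ∀ A : C,
    (∃ B : C, Nonempty (ExactPairing A B)) ∨ (∃ B : C, Nonempty (ExactPairing B A)))
    {L K : ThickSubcat C} (hLK : L.carrier ⊆ K.carrier) (I : ThickIdeal C)
    (hI : ∀ A ∈ I.carrier, ThickSubcat.AllFactor L K A) : ThickIdeal C where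
  carrier := {X | ∀ F : C ⥤ C, IsStabilizing F → ThickSubcat.AllFactor L K (F.obj X)}
  zero_mem A hA F hF := hI _ (hF.map_mem I A (I.zero_mem A hA))
  iso_closed e hA F hF :=
    (hA F hF).of_retract (F.map e.inv) (F.map e.hom) (by simp [← F.map_comp])
  shift_closed A n hA F hF := hA _ ((IsStabilizing.shiftFunctor n).comp hF)
  triangle_closed T hT h₁ h₂ F hF :=
    ThickSubcat.AllFactor.middle hLK (F.map T.mor₂) (F.map T.mor₃)
      (hF.weaklyExact _ _ (isWeakKer_of_distTriang _ (rot_of_distTriang _ hT))) (h₂ F hF)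
      (h₁ _ ((IsStabilizing.shiftFunctor 1).comp hF))
  summand_closed A B h F hF :=
    (h F hF).of_retract (F.map biprod.inl) (F.map biprod.fst) (by simp [← F.map_comp])
  tensor_right A hA B F hF := hA _
    (IsStabilizing.comp ⟨isWeaklyExact_tensorRight B (hdual B),
      fun I A hA => I.tensor_right A hA B⟩ hF)
  tensor_left A hA B F hF := hA _
    (IsStabilizing.comp ⟨isWeaklyExact_tensorLeft B (hdual B),
      fun I A hA => I.tensor_left A hA B⟩ hF)

theorem genIdeal_union_inter_subset (hdual : ∀ A : C,
    (∃ B : C, Nonempty (ExactPairing A B)) ∨ (∃ B : C, Nonempty (ExactPairing B A)))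
    (I J K P : ThickIdeal C)
    (hI : I.carrier ∩ K.carrier ⊆ P.carrier) (hJ : J.carrier ∩ K.carrier ⊆ P.carrier) :
    (genIdeal C (I.carrier ∪ J.carrier)).carrier ∩ K.carrier ⊆ P.carrier := by
  let L := P.toThickSubcat.inter K.toThickSubcat
  have hLK : L.carrier ⊆ K.carrier := Set.inter_subset_right
  have key : ∀ M : ThickIdeal C, M.carrier ∩ K.carrier ⊆ P.carrier →
      ∀ A ∈ M.carrier, ThickSubcat.AllFactor L K.toThickSubcat A := by
    intro M hM A hA Y hY f
    obtain ⟨B, Z, a, b, hab, hZ⟩ := exists_factorization_of_dualizable (hdual A) f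
    have hZM : Z ∈ M.carrier ∩ K.carrier := by
      rcases hZ with rfl | rfl
      · exact ⟨M.tensor_left _ hA _, K.tensor_right _ (K.tensor_right _ hY _) _⟩
      · exact ⟨M.tensor_right _ hA _, K.tensor_left _ (K.tensor_left _ hY _) _⟩
    exact ⟨Z, ⟨hM hZM, hZM.2⟩, a, b, hab⟩
  rintro X ⟨hX, hXK⟩
  have hX' := hX (factorIdeal hdual hLK I (key I hI)) (by
    rintro A (hA | hA) F hF
    · exact key I hI _ (hF.map_mem I A hA)
    · exact key J hJ _ (hF.map_mem J A hA))
  obtain ⟨Z, hZ, a, b, hab⟩ := hX' (𝟭 C) IsStabilizing.id X hXK (𝟙 X)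
  exact P.mem_of_retract a b hab hZ.1

theorem inter_subset_of_tensor_mem (hdual : ∀ A : C,
    (∃ B : C, Nonempty (ExactPairing A B)) ∨ (∃ B : C, Nonempty (ExactPairing B A)))
    (I J P : ThickIdeal C)
    (h : ∀ A ∈ I.carrier, ∀ B ∈ J.carrier, A ⊗ B ∈ P.carrier) :
    I.carrier ∩ J.carrier ⊆ P.carrier := by
  rintro A ⟨hI, hJ⟩
  obtain ⟨B, Z, a, b, hab, hZ⟩ := exists_factorization_of_dualizable (hdual A) (𝟙 A)
  refine P.mem_of_retract a b hab ?_
  rcases hZ with rfl | rfl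
  · exact h _ (I.tensor_right _ hI _) _ hJ
  · exact h _ hI _ (J.tensor_left _ hJ _)

theorem subset_genIdeal (S : Set C) : S ⊆ (genIdeal C S).carrier := fun _ hA _ hI => hI hA

/-- The union of a nonempty chain of thick ideals. -/
def chainUnion (c : Set (Set C)) (hc : IsChain (· ⊆ ·) c) (hne : c.Nonempty)
    (h : ∀ s ∈ c, ∃ I : ThickIdeal C, I.carrier = s) : ThickIdeal C where
  carrier := ⋃₀ c
  zero_mem A hA := by
    obtain ⟨s, hs⟩ := hne
    obtain ⟨I, rfl⟩ := h s hs
    exact ⟨_, hs, I.zero_mem A hA⟩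
  iso_closed e := by
    rintro ⟨s, hs, hA⟩
    obtain ⟨I, rfl⟩ := h s hs
    exact ⟨_, hs, I.iso_closed e hA⟩
  shift_closed A n := by
    rintro ⟨s, hs, hA⟩
    obtain ⟨I, rfl⟩ := h s hs
    exact ⟨_, hs, I.shift_closed A n hA⟩
  triangle_closed T hT := by
    rintro ⟨s, hs, h₁⟩ ⟨t, ht, h₂⟩
    rcases hc.total hs ht with hst | hst
    · obtain ⟨I, rfl⟩ := h t ht
      exact ⟨_, ht, I.triangle_closed T hT (hst h₁) h₂⟩
    · obtain ⟨I, rfl⟩ := h s hs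
      exact ⟨_, hs, I.triangle_closed T hT h₁ (hst h₂)⟩
  summand_closed A B := by
    rintro ⟨s, hs, hA⟩
    obtain ⟨I, rfl⟩ := h s hs
    exact ⟨_, hs, I.summand_closed A B hA⟩
  tensor_right A := by
    rintro ⟨s, hs, hA⟩ B
    obtain ⟨I, rfl⟩ := h s hs
    exact ⟨_, hs, I.tensor_right A hA B⟩
  tensor_left A := by
    rintro ⟨s, hs, hA⟩ B
    obtain ⟨I, rfl⟩ := h s hs
    exact ⟨_, hs, I.tensor_left A hA B⟩

theorem exists_maximal_thickIdeal_notMem (Q : ThickIdeal C) {A : C} (hA : A ∉ Q.carrier) :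
    ∃ P : ThickIdeal C, Q.carrier ⊆ P.carrier ∧ A ∉ P.carrier ∧
      ∀ I : ThickIdeal C, P.carrier ⊆ I.carrier → A ∉ I.carrier → I.carrier ⊆ P.carrier := by
  obtain ⟨_, hQ, ⟨P, rfl, hAP⟩, hmax⟩ :=
    zorn_subset_nonempty {s : Set C | ∃ I : ThickIdeal C, I.carrier = s ∧ A ∉ s}
      (fun c hcS hc hne => ⟨⋃₀ c,
        ⟨chainUnion c hc hne fun s hs => (hcS hs).imp fun _ h => h.1, rfl, by
          rintro ⟨s, hs, hAs⟩
          obtain ⟨_, _, h⟩ := hcS hs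
          exact h hAs⟩, fun _ => Set.subset_sUnion_of_mem⟩) Q.carrier ⟨Q, rfl, hA⟩
  exact ⟨P, hQ, hAP, fun I hPI hAI => hmax ⟨I, rfl, hAI⟩ hPI⟩

theorem isPrime_of_maximal_notMem (hdual : ∀ A : C,
    (∃ B : C, Nonempty (ExactPairing A B)) ∨ (∃ B : C, Nonempty (ExactPairing B A)))
    (P : ThickIdeal C) {A : C} (hA : A ∉ P.carrier)
    (hmax : ∀ I : ThickIdeal C, P.carrier ⊆ I.carrier → A ∉ I.carrier →
      I.carrier ⊆ P.carrier) : P.IsPrime := by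
  refine ⟨fun h => hA (h ▸ Set.mem_univ A), fun I J hIJ => ?_⟩
  by_contra! hcon
  have key : ∀ M : ThickIdeal C, ¬ M.carrier ⊆ P.carrier →
      A ∈ (genIdeal C (M.carrier ∪ P.carrier)).carrier := by
    intro M hM
    by_contra hAM
    exact hM ((Set.subset_union_left.trans (subset_genIdeal _)).trans
      (hmax _ (Set.subset_union_right.trans (subset_genIdeal _)) hAM))
  have h₁ : (genIdeal C (J.carrier ∪ P.carrier)).carrier ∩ I.carrier ⊆ P.carrier :=
    genIdeal_union_inter_subset hdual J P I P
      (Set.inter_comm _ _ ▸ inter_subset_of_tensor_mem hdual I J P hIJ) Set.inter_subset_left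
  exact hA (genIdeal_union_inter_subset hdual I P (genIdeal C (J.carrier ∪ P.carrier)) P
    (Set.inter_comm _ _ ▸ h₁) Set.inter_subset_left ⟨key I hcon.1, key J hcon.2⟩)

end

/-- If every object of `K` is either left or right dualizable,
then every thick two-sided ideal of `K` is semiprime. -/
theorem dualizable_ideals_semiprime
    (hdual : ∀ A : C,
      (∃ B : C, Nonempty (ExactPairing A B)) ∨
        (∃ B : C, Nonempty (ExactPairing B A))) :
    ∀ I : ThickIdeal C, I.IsSemiprime := by
  intro Q
  refine ⟨{P | P.IsPrime ∧ Q.carrier ⊆ P.carrier}, fun P hP => hP.1,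
    (Set.subset_iInter₂ fun P hP => hP.2).antisymm fun A hA => ?_⟩
  by_contra hAQ
  obtain ⟨P, hQP, hAP, hmax⟩ := exists_maximal_thickIdeal_notMem Q hAQ
  exact hAP (Set.mem_iInter₂.1 hA P ⟨isPrime_of_maximal_notMem hdual P hAP hmax, hQP⟩)
end

section
/- Let K be a monoidal triangulated category in which every object is either left or right dualizable. If K has a non-zero nilpotent object M (i.e. M ≇ 0 but M^{⊗n} ≅ 0 for some n > 0), then not all prime ideals of K are completely prime; consequently the universal support datum V does not have the tensor product property. -/
open CategoryTheory CategoryTheory.Limits CategoryTheory.Pretriangulated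
open CategoryTheory.MonoidalCategory

universe w v u

variable (C : Type u) [Category.{v} C] [MonoidalCategory C] [Preadditive C]
  [HasZeroObject C] [HasBinaryBiproducts C] [HasShift C ℤ]
  [∀ n : ℤ, (shiftFunctor C n).Additive] [Pretriangulated C]

variable {C}

variable (C)

section

variable {𝒟 : Type*} [Category 𝒟] [MonoidalCategory 𝒟]

/-- Left or right dualizability of an object. -/
def IsDualizable (A : 𝒟) : Prop :=
  (∃ B : 𝒟, Nonempty (ExactPairing A B)) ∨ (∃ B : 𝒟, Nonempty (ExactPairing B A))

lemma IsDualizable.exists_retract {A : 𝒟} (h : IsDualizable A) :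
    ∃ B : 𝒟, Nonempty (Retract A (A ⊗ B ⊗ A)) := by
  obtain ⟨B, ⟨_⟩⟩ | ⟨B, ⟨_⟩⟩ := h
  · exact ⟨B, ⟨(λ_ A).inv ≫ η_ A B ▷ A ≫ (α_ _ _ _).hom, A ◁ ε_ A B ≫ (ρ_ A).hom, by simp⟩⟩
  · exact ⟨B, ⟨(ρ_ A).inv ≫ A ◁ η_ B A, (α_ _ _ _).inv ≫ ε_ B A ▷ A ≫ (λ_ A).hom, by simp⟩⟩

lemma IsDualizable.exists_factor_to {A Y : 𝒟} (h : IsDualizable Y) (f : A ⟶ Y) :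
    ∃ D : 𝒟, (∃ (a : A ⟶ (Y ⊗ D) ⊗ A) (b : (Y ⊗ D) ⊗ A ⟶ Y), f = a ≫ b) ∨
      ∃ (a : A ⟶ A ⊗ (D ⊗ Y)) (b : A ⊗ (D ⊗ Y) ⟶ Y), f = a ≫ b := by
  obtain ⟨D, ⟨_⟩⟩ | ⟨D, ⟨_⟩⟩ := h
  · refine ⟨D, .inl ⟨(λ_ A).inv ≫ η_ Y D ▷ A,
      (Y ⊗ D) ◁ f ≫ (α_ _ _ _).hom ≫ Y ◁ ε_ Y D ≫ (ρ_ Y).hom, ?_⟩⟩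
    simp only [Category.assoc]
    rw [← whisker_exchange_assoc]
    simp
  · refine ⟨D, .inr ⟨(ρ_ A).inv ≫ A ◁ η_ D Y,
      f ▷ (D ⊗ Y) ≫ (α_ _ _ _).inv ≫ ε_ D Y ▷ Y ≫ (λ_ Y).hom, ?_⟩⟩
    simp only [Category.assoc]
    rw [whisker_exchange_assoc]
    simp

lemma IsDualizable.exists_factor_from {A Y : 𝒟} (h : IsDualizable Y) (f : Y ⟶ A) :
    ∃ D : 𝒟, (∃ (a : Y ⟶ (Y ⊗ D) ⊗ A) (b : (Y ⊗ D) ⊗ A ⟶ A), f = a ≫ b) ∨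
      ∃ (a : Y ⟶ A ⊗ (D ⊗ Y)) (b : A ⊗ (D ⊗ Y) ⟶ A), f = a ≫ b := by
  obtain ⟨D, ⟨_⟩⟩ | ⟨D, ⟨_⟩⟩ := h
  · refine ⟨D, .inr ⟨(λ_ Y).inv ≫ η_ Y D ▷ Y ≫ (α_ _ _ _).hom ≫ f ▷ (D ⊗ Y),
      A ◁ ε_ Y D ≫ (ρ_ A).hom, ?_⟩⟩
    simp only [Category.assoc]
    rw [← whisker_exchange_assoc]
    simp
  · refine ⟨D, .inl ⟨(ρ_ Y).inv ≫ Y ◁ η_ D Y ≫ (α_ _ _ _).inv ≫ (Y ⊗ D) ◁ f,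
      ε_ D Y ▷ A ≫ (λ_ A).hom, ?_⟩⟩
    simp only [Category.assoc]
    rw [whisker_exchange_assoc]
    simp

lemma IsDualizable.isZero_tensor_left [HasZeroObject 𝒟] [HasZeroMorphisms 𝒟] {A B : 𝒟}
    (hB : IsDualizable B) (hA : IsZero A) :
    IsZero (B ⊗ A) := by
  obtain ⟨D, ⟨_⟩⟩ | ⟨D, ⟨_⟩⟩ := hB
  · have := (tensorLeftAdjunction B D).isRightAdjoint
    exact (tensorLeft B).map_isZero hA
  · have := (tensorLeftAdjunction D B).isLeftAdjoint
    exact (tensorLeft B).map_isZero hA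

lemma IsDualizable.isZero_tensor_right [HasZeroObject 𝒟] [HasZeroMorphisms 𝒟] {A B : 𝒟}
    (hB : IsDualizable B) (hA : IsZero A) :
    IsZero (A ⊗ B) := by
  obtain ⟨D, ⟨_⟩⟩ | ⟨D, ⟨_⟩⟩ := hB
  · have := (tensorRightAdjunction B D).isLeftAdjoint
    exact (tensorRight B).map_isZero hA
  · have := (tensorRightAdjunction D B).isRightAdjoint
    exact (tensorRight B).map_isZero hA

end

section

variable {C}

lemma ThickSubcat.mem_of_retract_s15 (P : ThickSubcat C) {X Y : C} (r : Retract X Y)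
    (hY : Y ∈ P.carrier) : X ∈ P.carrier := by
  obtain ⟨Z, g, h, hT⟩ := distinguished_cocone_triangle r.i
  have hh : h = 0 := by
    have h₁ : h ≫ r.i⟦(1 : ℤ)⟧' = 0 := comp_distTriang_mor_zero₃₁ _ hT
    have h₂ : h ≫ r.i⟦(1 : ℤ)⟧' ≫ r.r⟦(1 : ℤ)⟧' = h := by
      rw [← Functor.map_comp, r.retract]; simp
    rw [← h₂, ← Category.assoc, h₁, zero_comp]
  obtain ⟨e, -⟩ := exists_iso_binaryBiproduct_of_distTriang _ hT hh
  exact P.summand_closed X Z (P.iso_closed e hY)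

lemma ThickSubcat.biprod_mem_s15 (P : ThickSubcat C) {X Y : C} (hX : X ∈ P.carrier)
    (hY : Y ∈ P.carrier) : (X ⊞ Y) ∈ P.carrier := by
  have h := P.triangle_closed _
    (inv_rot_of_distTriang _ (binaryBiproductTriangle_distinguished X Y))
    (P.shift_closed _ _ hY) hX
  exact h

/-- An object whose identity is a sum of two maps factoring through objects of a thick
subcategory lies in that subcategory. -/
lemma ThickSubcat.mem_of_id_eq_add (P : ThickSubcat C) {X Y Z : C} (hY : Y ∈ P.carrier)
    (hZ : Z ∈ P.carrier) (a : X ⟶ Y) (b : Y ⟶ X) (c : X ⟶ Z) (d : Z ⟶ X)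
    (h : a ≫ b + c ≫ d = 𝟙 X) : X ∈ P.carrier :=
  P.mem_of_retract_s15 ⟨biprod.lift a c, biprod.desc b d, by simpa [biprod.lift_desc] using h⟩
    (P.biprod_mem_s15 hY hZ)

/-- A right adjoint preserves weak kernels, hence detects membership of the third vertex of a
distinguished triangle in a thick subcategory. -/
lemma ThickSubcat.obj₃_mem_of_rightAdjoint (P : ThickSubcat C) {L F : C ⥤ C} (adj : L ⊣ F)
    (T : Triangle C) (hT : T ∈ distTriang C) (h₂ : F.obj T.obj₂ ∈ P.carrier)
    (h₁' : F.obj (T.obj₁⟦(1 : ℤ)⟧) ∈ P.carrier) (h₂' : F.obj (T.obj₂⟦(1 : ℤ)⟧) ∈ P.carrier) :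
    F.obj T.obj₃ ∈ P.carrier := by
  have : F.IsRightAdjoint := adj.isRightAdjoint
  have : L.IsLeftAdjoint := adj.isLeftAdjoint
  have weak : ∀ {X Y Z : C} (f : X ⟶ Y) (g : Y ⟶ Z),
      (∀ {V : C} (k : V ⟶ Y), k ≫ g = 0 → ∃ l, k = l ≫ f) →
      ∀ {V : C} (k : V ⟶ F.obj Y), k ≫ F.map g = 0 → ∃ l, k = l ≫ F.map f := by
    intro X Y Z f g H V k hk
    obtain ⟨l, hl⟩ := H ((adj.homEquiv _ _).symm k) (by
      rw [← adj.homEquiv_naturality_right_symm, hk, adj.homEquiv_counit, L.map_zero, zero_comp])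
    refine ⟨adj.homEquiv _ _ l, ?_⟩
    rw [← adj.homEquiv_naturality_right, ← hl, Equiv.apply_symm_apply]
  obtain ⟨W, a, w, hW⟩ := distinguished_cocone_triangle₁ (F.map (T.mor₁⟦(1 : ℤ)⟧'))
  have hWP : W ∈ P.carrier :=
    P.triangle_closed _ (inv_rot_of_distTriang _ (inv_rot_of_distTriang _ hW))
      (P.shift_closed _ _ h₁') (P.shift_closed _ _ h₂')
  have ha : a ≫ F.map (T.mor₁⟦(1 : ℤ)⟧') = 0 := comp_distTriang_mor_zero₁₂ _ hW
  obtain ⟨ψ, hψ⟩ := weak T.mor₃ _ (T.coyoneda_exact₁ hT) a ha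
  have hT₃₁ : F.map T.mor₃ ≫ F.map (T.mor₁⟦(1 : ℤ)⟧') = 0 := by
    rw [← F.map_comp, comp_distTriang_mor_zero₃₁ _ hT, F.map_zero]
  obtain ⟨φ, hφ⟩ : ∃ φ, F.map T.mor₃ = φ ≫ a := Triangle.coyoneda_exact₂ _ hW _ hT₃₁
  obtain ⟨k, hk⟩ := weak T.mor₂ T.mor₃ (T.coyoneda_exact₃ hT) (𝟙 _ - φ ≫ ψ) (by
    rw [Preadditive.sub_comp, Category.assoc, ← hψ, ← hφ]; simp)
  exact P.mem_of_id_eq_add hWP h₂ φ ψ k (F.map T.mor₂) (by rw [← hk]; abel)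

/-- A left adjoint preserves weak cokernels, hence detects membership of the third vertex of a
distinguished triangle in a thick subcategory. -/
lemma ThickSubcat.obj₃_mem_of_leftAdjoint (P : ThickSubcat C) {F R : C ⥤ C} (adj : F ⊣ R)
    (T : Triangle C) (hT : T ∈ distTriang C) (h₁ : F.obj T.obj₁ ∈ P.carrier)
    (h₂ : F.obj T.obj₂ ∈ P.carrier) (h₁' : F.obj (T.obj₁⟦(1 : ℤ)⟧) ∈ P.carrier) :
    F.obj T.obj₃ ∈ P.carrier := by
  have : F.IsLeftAdjoint := adj.isLeftAdjoint
  have : R.IsRightAdjoint := adj.isRightAdjoint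
  have weak : ∀ {X Y Z : C} (f : X ⟶ Y) (g : Y ⟶ Z),
      (∀ {V : C} (k : Y ⟶ V), f ≫ k = 0 → ∃ l, k = g ≫ l) →
      ∀ {V : C} (k : F.obj Y ⟶ V), F.map f ≫ k = 0 → ∃ l, k = F.map g ≫ l := by
    intro X Y Z f g H V k hk
    obtain ⟨l, hl⟩ := H (adj.homEquiv _ _ k) (by
      rw [← adj.homEquiv_naturality_left, hk, adj.homEquiv_unit, R.map_zero, comp_zero])
    refine ⟨(adj.homEquiv _ _).symm l, ?_⟩
    rw [← adj.homEquiv_naturality_left_symm, ← hl, Equiv.symm_apply_apply]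
  obtain ⟨W, a, w, hW⟩ := distinguished_cocone_triangle (F.map T.mor₁)
  have hWP : W ∈ P.carrier := P.triangle_closed _ hW h₁ h₂
  have ha : F.map T.mor₁ ≫ a = 0 := comp_distTriang_mor_zero₁₂ _ hW
  obtain ⟨ψ, hψ⟩ := weak T.mor₁ T.mor₂ (T.yoneda_exact₂ hT) a ha
  have hT₁₂ : F.map T.mor₁ ≫ F.map T.mor₂ = 0 := by
    rw [← F.map_comp, comp_distTriang_mor_zero₁₂ _ hT, F.map_zero]
  obtain ⟨φ, hφ⟩ : ∃ φ, F.map T.mor₂ = a ≫ φ := Triangle.yoneda_exact₂ _ hW _ hT₁₂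
  obtain ⟨k, hk⟩ := weak T.mor₂ T.mor₃ (T.yoneda_exact₃ hT) (𝟙 _ - ψ ≫ φ) (by
    rw [Preadditive.comp_sub, ← Category.assoc, ← hψ, ← hφ]; simp)
  exact P.mem_of_id_eq_add hWP h₁' ψ φ (F.map T.mor₃) k (by rw [← hk]; abel)

/-- The objects `A` such that tensoring with `I` on either side lands in `P`. -/
def tensorColon (P I : ThickIdeal C) : Set C :=
  {A | ∀ X ∈ I.carrier, X ⊗ A ∈ P.carrier ∧ A ⊗ X ∈ P.carrier}

lemma ThickIdeal.mem_of_forall_mem (P : ThickIdeal C) {A : C} (h : IsDualizable A)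
    (hA : ∀ B : C, A ⊗ B ⊗ A ∈ P.carrier) : A ∈ P.carrier := by
  obtain ⟨B, ⟨r⟩⟩ := h.exists_retract
  exact P.mem_of_retract_s15 r (hA B)

lemma exists_factor_to_of_mem_tensorColon {P I : ThickIdeal C} {A Y : C}
    (hA : A ∈ tensorColon P I) (hY : Y ∈ I.carrier) (h : IsDualizable Y) (f : A ⟶ Y) :
    ∃ p ∈ P.carrier, ∃ (a : A ⟶ p) (b : p ⟶ Y), f = a ≫ b := by
  obtain ⟨D, ⟨a, b, e⟩ | ⟨a, b, e⟩⟩ := h.exists_factor_to f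
  · exact ⟨_, (hA _ (I.tensor_right _ hY D)).1, a, b, e⟩
  · exact ⟨_, (hA _ (I.tensor_left _ hY D)).2, a, b, e⟩

lemma exists_factor_from_of_mem_tensorColon {P I : ThickIdeal C} {A Y : C}
    (hA : A ∈ tensorColon P I) (hY : Y ∈ I.carrier) (h : IsDualizable Y) (f : Y ⟶ A) :
    ∃ p ∈ P.carrier, ∃ (a : Y ⟶ p) (b : p ⟶ A), f = a ≫ b := by
  obtain ⟨D, ⟨a, b, e⟩ | ⟨a, b, e⟩⟩ := h.exists_factor_from f
  · exact ⟨_, (hA _ (I.tensor_right _ hY D)).1, a, b, e⟩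
  · exact ⟨_, (hA _ (I.tensor_left _ hY D)).2, a, b, e⟩

lemma exists_factor_shift_to_of_mem_tensorColon {P I : ThickIdeal C} {A Y : C}
    (hdual : ∀ X : C, IsDualizable X) (hA : A ∈ tensorColon P I) (hY : Y ∈ I.carrier)
    (n : ℤ) (f : A⟦n⟧ ⟶ Y) :
    ∃ p ∈ P.carrier, ∃ (a : A⟦n⟧ ⟶ p) (b : p ⟶ Y), f = a ≫ b := by
  obtain ⟨p, hp, a, b, e⟩ := exists_factor_to_of_mem_tensorColon hA (I.shift_closed Y (-n) hY)
    (hdual _) ((shiftShiftNeg A n).inv ≫ f⟦-n⟧')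
  have e' : f⟦-n⟧' = ((shiftShiftNeg A n).hom ≫ a) ≫ b := by
    rw [Category.assoc, ← e, Iso.hom_inv_id_assoc]
  refine ⟨p⟦n⟧, P.shift_closed _ _ hp,
    (shiftNegShift (A⟦n⟧) n).inv ≫ ((shiftShiftNeg A n).hom ≫ a)⟦n⟧',
    b⟦n⟧' ≫ (shiftNegShift Y n).hom, ?_⟩
  rw [Category.assoc, ← Functor.map_comp_assoc, ← e']
  exact (shiftFunctorCompIsoId_naturality_1 f (-n) n (neg_add_cancel n)).symm

lemma exists_factor_shift_from_of_mem_tensorColon {P I : ThickIdeal C} {A Y : C}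
    (hdual : ∀ X : C, IsDualizable X) (hA : A ∈ tensorColon P I) (hY : Y ∈ I.carrier)
    (n : ℤ) (f : Y ⟶ A⟦n⟧) :
    ∃ p ∈ P.carrier, ∃ (a : Y ⟶ p) (b : p ⟶ A⟦n⟧), f = a ≫ b := by
  obtain ⟨p, hp, a, b, e⟩ := exists_factor_from_of_mem_tensorColon hA (I.shift_closed Y (-n) hY)
    (hdual _) (f⟦-n⟧' ≫ (shiftShiftNeg A n).hom)
  have e' : f⟦-n⟧' = a ≫ b ≫ (shiftShiftNeg A n).inv := by
    rw [← Category.assoc, ← e, Category.assoc, Iso.hom_inv_id, Category.comp_id]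
  refine ⟨p⟦n⟧, P.shift_closed _ _ hp, (shiftNegShift Y n).inv ≫ a⟦n⟧',
    (b ≫ (shiftShiftNeg A n).inv)⟦n⟧' ≫ (shiftNegShift (A⟦n⟧) n).hom, ?_⟩
  rw [Category.assoc, ← Functor.map_comp_assoc, ← e']
  exact (shiftFunctorCompIsoId_naturality_1 f (-n) n (neg_add_cancel n)).symm

lemma obj_shift_mem_of_rightAdjoint {P I : ThickIdeal C} {A : C}
    (hdual : ∀ X : C, IsDualizable X) (hA : A ∈ tensorColon P I) (n : ℤ) {L F : C ⥤ C}
    (adj : L ⊣ F) (hF : ∀ X ∈ P.carrier, F.obj X ∈ P.carrier)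
    (hI : L.obj (F.obj (A⟦n⟧)) ∈ I.carrier) : F.obj (A⟦n⟧) ∈ P.carrier := by
  obtain ⟨p, hp, a, b, e⟩ :=
    exists_factor_shift_from_of_mem_tensorColon hdual hA hI n (adj.counit.app _)
  refine P.mem_of_retract_s15 ⟨adj.unit.app _ ≫ F.map a, F.map b, ?_⟩ (hF p hp)
  rw [Category.assoc, ← F.map_comp, ← e]
  exact adj.right_triangle_components _

lemma obj_shift_mem_of_leftAdjoint {P I : ThickIdeal C} {A : C}
    (hdual : ∀ X : C, IsDualizable X) (hA : A ∈ tensorColon P I) (n : ℤ) {F R : C ⥤ C}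
    (adj : F ⊣ R) (hF : ∀ X ∈ P.carrier, F.obj X ∈ P.carrier)
    (hI : R.obj (F.obj (A⟦n⟧)) ∈ I.carrier) : F.obj (A⟦n⟧) ∈ P.carrier := by
  obtain ⟨p, hp, a, b, e⟩ :=
    exists_factor_shift_to_of_mem_tensorColon hdual hA hI n (adj.unit.app _)
  refine P.mem_of_retract_s15 ⟨F.map a, F.map b ≫ adj.counit.app _, ?_⟩ (hF p hp)
  rw [← Category.assoc, ← F.map_comp, ← e]
  exact adj.left_triangle_components _

lemma shift_mem_tensorColon {P I : ThickIdeal C} {A : C} (hdual : ∀ X : C, IsDualizable X)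
    (hA : A ∈ tensorColon P I) (n : ℤ) : A⟦n⟧ ∈ tensorColon P I := by
  intro X hX
  have hl : ∀ Y ∈ P.carrier, (tensorLeft X).obj Y ∈ P.carrier := fun Y hY ↦ P.tensor_left Y hY X
  have hr : ∀ Y ∈ P.carrier, (tensorRight X).obj Y ∈ P.carrier := fun Y hY ↦ P.tensor_right Y hY X
  have il : ∀ D, (tensorLeft D).obj ((tensorLeft X).obj (A⟦n⟧)) ∈ I.carrier := fun D ↦
    I.tensor_left _ (I.tensor_right X hX _) D
  have ir : ∀ D, (tensorRight D).obj ((tensorRight X).obj (A⟦n⟧)) ∈ I.carrier := fun D ↦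
    I.tensor_right _ (I.tensor_left X hX _) D
  obtain ⟨D, ⟨_⟩⟩ | ⟨D, ⟨_⟩⟩ := hdual X
  · exact ⟨obj_shift_mem_of_rightAdjoint hdual hA n (tensorLeftAdjunction X D) hl (il D),
      obj_shift_mem_of_leftAdjoint hdual hA n (tensorRightAdjunction X D) hr (ir D)⟩
  · exact ⟨obj_shift_mem_of_leftAdjoint hdual hA n (tensorLeftAdjunction D X) hl (il D),
      obj_shift_mem_of_rightAdjoint hdual hA n (tensorRightAdjunction D X) hr (ir D)⟩

lemma obj₃_mem_tensorColon {P I : ThickIdeal C} (hdual : ∀ X : C, IsDualizable X)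
    (T : Triangle C) (hT : T ∈ distTriang C) (h₁ : T.obj₁ ∈ tensorColon P I)
    (h₂ : T.obj₂ ∈ tensorColon P I) : T.obj₃ ∈ tensorColon P I := by
  intro X hX
  have h₁' := shift_mem_tensorColon hdual h₁ 1 X hX
  have h₂' := shift_mem_tensorColon hdual h₂ 1 X hX
  obtain ⟨D, ⟨_⟩⟩ | ⟨D, ⟨_⟩⟩ := hdual X
  · exact ⟨P.obj₃_mem_of_rightAdjoint (tensorLeftAdjunction X D) T hT (h₂ X hX).1 h₁'.1 h₂'.1,
      P.obj₃_mem_of_leftAdjoint (tensorRightAdjunction X D) T hT (h₁ X hX).2 (h₂ X hX).2 h₁'.2⟩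
  · exact ⟨P.obj₃_mem_of_leftAdjoint (tensorLeftAdjunction D X) T hT (h₁ X hX).1 (h₂ X hX).1 h₁'.1,
      P.obj₃_mem_of_rightAdjoint (tensorRightAdjunction D X) T hT (h₂ X hX).2 h₁'.2 h₂'.2⟩

/-- When every object is dualizable, `tensorColon P I` is a thick ideal. -/
def colonIdeal (hdual : ∀ X : C, IsDualizable X) (P I : ThickIdeal C) : ThickIdeal C where
  carrier := tensorColon P I
  zero_mem A hA X _ := ⟨P.tensor_left A (P.zero_mem A hA) X, P.tensor_right A (P.zero_mem A hA) X⟩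
  iso_closed e hA X hX := ⟨P.iso_closed (whiskerLeftIso X e) (hA X hX).1,
    P.iso_closed (whiskerRightIso e X) (hA X hX).2⟩
  shift_closed _ n hA := shift_mem_tensorColon hdual hA n
  triangle_closed T hT h₁ h₂ := obj₃_mem_tensorColon hdual T hT h₁ h₂
  summand_closed A B hAB X hX :=
    let r : Retract A (A ⊞ B) := ⟨biprod.inl, biprod.fst, by simp⟩
    ⟨P.mem_of_retract_s15 (r.map (tensorLeft X)) (hAB X hX).1,
      P.mem_of_retract_s15 (r.map (tensorRight X)) (hAB X hX).2⟩
  tensor_right A hA B X hX := ⟨P.iso_closed (α_ X A B) (P.tensor_right _ (hA X hX).1 B),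
    P.iso_closed (α_ A B X).symm (hA _ (I.tensor_left X hX B)).2⟩
  tensor_left A hA B X hX := ⟨P.iso_closed (α_ X B A) (hA _ (I.tensor_right X hX B)).1,
    P.iso_closed (α_ B A X).symm (P.tensor_left _ (hA X hX).2 B)⟩

lemma subset_colonIdeal (hdual : ∀ X : C, IsDualizable X) (P I : ThickIdeal C) :
    P.carrier ⊆ (colonIdeal hdual P I).carrier :=
  fun A hA X _ ↦ ⟨P.tensor_left A hA X, P.tensor_right A hA X⟩

lemma subset_colonIdeal_of_tensor_mem (hdual : ∀ X : C, IsDualizable X) {P I J : ThickIdeal C}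
    (h : ∀ A ∈ I.carrier, ∀ B ∈ J.carrier, A ⊗ B ∈ P.carrier) :
    J.carrier ⊆ (colonIdeal hdual P I).carrier := fun A hA X hX ↦
  ⟨h X hX A hA, P.mem_of_forall_mem (hdual _) fun B ↦
    P.iso_closed (α_ A X (B ⊗ A ⊗ X)).symm <| P.tensor_left _
      (P.iso_closed (α_ X (B ⊗ A) X ≪≫ whiskerLeftIso X (α_ B A X)) <|
        P.tensor_right _ (h X hX _ (J.tensor_left A hA B)) X) A⟩

/-- The thick ideal of zero objects. -/
def zeroIdeal (hdual : ∀ X : C, IsDualizable X) : ThickIdeal C where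
  carrier := {A | IsZero A}
  zero_mem _ hA := hA
  iso_closed e hA := hA.of_iso e.symm
  shift_closed _ n hA := (shiftFunctor C n).map_isZero hA
  triangle_closed T hT h₁ h₂ := (T.isZero₃_iff_isIso₁ hT).2 ⟨0, h₁.eq_of_src _ _, h₂.eq_of_src _ _⟩
  summand_closed _ _ h := (biprod_isZero_iff _ _).1 h |>.1
  tensor_right _ hA B := (hdual B).isZero_tensor_right hA
  tensor_left _ hA B := (hdual B).isZero_tensor_left hA

/-- The union of a nonempty directed family of thick ideals. -/
def ThickIdeal.directedUnion (c : Set (ThickIdeal C)) (hc : c.Nonempty)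
    (hd : ∀ I ∈ c, ∀ J ∈ c, I.carrier ⊆ J.carrier ∨ J.carrier ⊆ I.carrier) : ThickIdeal C where
  carrier := {A | ∃ I ∈ c, A ∈ I.carrier}
  zero_mem A hA := ⟨hc.some, hc.some_mem, hc.some.zero_mem A hA⟩
  iso_closed := fun e ⟨I, hI, hA⟩ ↦ ⟨I, hI, I.iso_closed e hA⟩
  shift_closed := fun A n ⟨I, hI, hA⟩ ↦ ⟨I, hI, I.shift_closed A n hA⟩
  triangle_closed := fun T hT ⟨I, hI, h₁⟩ ⟨J, hJ, h₂⟩ ↦ (hd I hI J hJ).elim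
    (fun h ↦ ⟨J, hJ, J.triangle_closed T hT (h h₁) h₂⟩)
    (fun h ↦ ⟨I, hI, I.triangle_closed T hT h₁ (h h₂)⟩)
  summand_closed := fun A B ⟨I, hI, h⟩ ↦ ⟨I, hI, I.summand_closed A B h⟩
  tensor_right := fun A ⟨I, hI, h⟩ B ↦ ⟨I, hI, I.tensor_right A h B⟩
  tensor_left := fun A ⟨I, hI, h⟩ B ↦ ⟨I, hI, I.tensor_left A h B⟩

lemma exists_maximal_not_mem (hdual : ∀ X : C, IsDualizable X) {M : C} (hM : ¬ IsZero M) :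
    ∃ P : ThickIdeal C, M ∉ P.carrier ∧
      ∀ Q : ThickIdeal C, P.carrier ⊆ Q.carrier → M ∉ Q.carrier → Q.carrier ⊆ P.carrier := by
  obtain ⟨_, -, ⟨⟨P, hP, rfl⟩, hmax⟩⟩ := zorn_subset_nonempty
    {S : Set C | ∃ P : ThickIdeal C, M ∉ P.carrier ∧ P.carrier = S} (by
      intro c hc hchain hne
      refine ⟨_, ⟨ThickIdeal.directedUnion {P | P.carrier ∈ c} ?_ ?_, ?_, rfl⟩, ?_⟩
      · obtain ⟨s, hs⟩ := hne
        obtain ⟨P, -, rfl⟩ := hc hs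
        exact ⟨P, hs⟩
      · exact fun I hI J hJ ↦ hchain.total hI hJ
      · rintro ⟨P, hP, hMP⟩
        obtain ⟨Q, hQ, e⟩ := hc hP
        exact hQ (e ▸ hMP)
      · intro s hs A hA
        obtain ⟨P, -, rfl⟩ := hc hs
        exact ⟨P, hs, hA⟩)
    (zeroIdeal hdual).carrier ⟨zeroIdeal hdual, hM, rfl⟩
  exact ⟨P, hP, fun Q hPQ hQ ↦ hmax ⟨Q, hQ, rfl⟩ hPQ⟩

/-- When every object is dualizable, each nonzero object is avoided by some prime ideal. -/
theorem exists_isPrime_not_mem (hdual : ∀ X : C, IsDualizable X) {M : C} (hM : ¬ IsZero M) :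
    ∃ P : ThickIdeal C, P.IsPrime ∧ M ∉ P.carrier := by
  obtain ⟨P, hP, hmax⟩ := exists_maximal_not_mem hdual hM
  refine ⟨P, ⟨fun h ↦ hP (h ▸ Set.mem_univ M), fun I J hIJ ↦ ?_⟩, hP⟩
  by_contra! hcon
  have hMI : M ∈ (colonIdeal hdual P I).carrier := by
    by_contra h
    exact hcon.2 ((subset_colonIdeal_of_tensor_mem hdual hIJ).trans
      (hmax _ (subset_colonIdeal hdual P I) h))
  have hMII : M ∈ (colonIdeal hdual P (colonIdeal hdual P I)).carrier := by
    by_contra h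
    refine hcon.1 (Set.Subset.trans ?_ (hmax _ (subset_colonIdeal hdual P _) h))
    exact fun A hA X hX ↦ (hX A hA).symm
  exact hP (P.mem_of_forall_mem (hdual M) fun B ↦
    (hMII _ ((colonIdeal hdual P I).tensor_left M hMI B)).2)

lemma ThickIdeal.mem_of_tpow_mem (P : ThickIdeal C)
    (hP : ∀ A B : C, A ⊗ B ∈ P.carrier → A ∈ P.carrier ∨ B ∈ P.carrier) {M : C} :
    ∀ n : ℕ, tpow C M n ∈ P.carrier → M ∈ P.carrier
  | 0, h => P.iso_closed (λ_ M) (P.tensor_right _ h M)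
  | n + 1, h => (hP _ _ h).elim (P.mem_of_tpow_mem hP n) id

end

/-- If every object of `K` is either left or right dualizable and
`K` has a non-zero nilpotent object, then not all prime ideals of `K` are
completely prime; consequently the universal support datum does not have the
tensor product property. -/
theorem nilpotent_implies_not_all_completelyPrime
    (hdual : ∀ A : C,
      (∃ B : C, Nonempty (ExactPairing A B)) ∨
        (∃ B : C, Nonempty (ExactPairing B A)))
    (M : C) (hM : ¬ IsZero M) (n : ℕ) (hn : 0 < n)
    (hz : IsZero (tpow C M n)) :
    (¬ ∀ P : ThickIdeal C, P.IsPrime → P.IsCompletelyPrime) ∧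
    ¬ (∀ A B : C, suppV C (A ⊗ B) = suppV C A ∩ suppV C B) := by
  obtain ⟨P, hP, hMP⟩ := exists_isPrime_not_mem hdual hM
  have key : ¬ ∀ A B : C, A ⊗ B ∈ P.carrier → A ∈ P.carrier ∨ B ∈ P.carrier := fun h ↦
    hMP (P.mem_of_tpow_mem h n (P.zero_mem _ hz))
  refine ⟨fun h ↦ key (h P hP).2, fun h ↦ key fun A B hAB ↦ ?_⟩
  by_contra! hcon
  have hmem : (⟨P, hP⟩ : Spc C) ∈ suppV C (A ⊗ B) := (h A B).symm ▸ ⟨hcon.1, hcon.2⟩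
  exact hmem hAB
end
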